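/- Let X̄^(1), …, X̄^(k) be time-homogeneous Markov chains with time indexed by ℕ and countable state spaces A_1, …, A_k, let Z̄ be a time-homogeneous Markov chain on a countable state space C, and let f_i: A_i → C be maps with (f_i(X̄^(i)_t))_{t≥0} =ᵈ Z̄ for all i = 1, …, k. Then there exists a time-homogeneous Markov chain (X^(1)_t, …, X^(k)_t)_{t≥0} on A_1×⋯×A_k such that (X^(i)_t)_{t≥0} =ᵈ X̄^(i) for each i, almost surely f_i(X^(i)_t) = f_j(X^(j)_t) for all i, j and all t ≥ 0, and the marginal processes X^(1), …, X^(k) may be taken mutually conditionally independent given the common image process (f_1(X^(1)_t))_{t≥0}. -/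

import Mathlib

open MeasureTheory Filter Topology
open scoped ENNReal Classical

/-- A probability vector on a countable state space. -/
def IsProbVec {U : Type*} (v : U → ℝ≥0∞) : Prop := ∑' u, v u = 1

/-- A row-stochastic matrix on a countable state space. -/
def IsStochastic {U : Type*} (P : U → U → ℝ≥0∞) : Prop := ∀ u, ∑' w, P u w = 1

/-- `μ` is the law of the time-homogeneous Markov chain `MC(v,P)`. -/
def IsMarkovChain {U : Type*} [MeasurableSpace U]
    (v : U → ℝ≥0∞) (P : U → U → ℝ≥0∞) (μ : Measure (ℕ → U)) : Prop :=
  IsProbabilityMeasure μ ∧ IsProbVec v ∧ IsStochastic P ∧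
    ∀ (k : ℕ) (a : ℕ → U),
      μ {ω | ∀ i ≤ k, ω i = a i} = v (a 0) * ∏ i ∈ Finset.range k, P (a i) (a (i + 1))

noncomputable def indic {Ω : Type*} (s : Set Ω) : Ω → ℝ := s.indicator fun _ => 1

/-- The family `X i` is mutually conditionally independent given `Z` under `μ`. -/
def iCondIndepGiven {Ω : Type*} [MeasurableSpace Ω] (μ : Measure Ω)
    {γ : Type*} [MeasurableSpace γ] (Z : Ω → γ)
    {ι : Type*} {α : ι → Type*} [∀ i, MeasurableSpace (α i)]
    (X : ∀ i, Ω → α i) : Prop :=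
  ∀ (s : Finset ι) (t : ι → Set Ω),
    (∀ i ∈ s, MeasurableSet[MeasurableSpace.comap (X i) inferInstance] (t i)) →
    μ[indic (⋂ i ∈ s, t i)|MeasurableSpace.comap Z inferInstance]
      =ᵐ[μ] ∏ i ∈ s, μ[indic (t i)|MeasurableSpace.comap Z inferInstance]

open ProbabilityTheory

/-- The cylinder of paths that agree with `a` up to time `n`. -/
def pathCylinder {U : Type*} (n : ℕ) (a : ℕ → U) : Set (ℕ → U) := {ω | ∀ i ≤ n, ω i = a i}

/-- The time shift on paths. -/
def pathShift {U : Type*} (n : ℕ) (ω : ℕ → U) : ℕ → U := fun m => ω (n + m)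

/-- Follow `a` strictly before time `n`, then follow `ω`. -/
def pathConcat {U : Type*} (n : ℕ) (a ω : ℕ → U) : ℕ → U :=
  fun m => if m < n then a m else ω (m - n)

section Paths

variable {U : Type*}

lemma mem_pathCylinder {n : ℕ} {a ω : ℕ → U} :
    ω ∈ pathCylinder n a ↔ ∀ i ≤ n, ω i = a i := Iff.rfl

lemma pathCylinder_congr {n : ℕ} {a b : ℕ → U} (h : ∀ i ≤ n, a i = b i) :
    pathCylinder n a = pathCylinder n b := by
  ext ω
  exact forall₂_congr fun i hi => by rw [h i hi]

lemma pathCylinder_succ_subset (n : ℕ) (a : ℕ → U) :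
    pathCylinder (n + 1) a ⊆ pathCylinder n a := by
  intro ω hω i hi
  exact hω i (by omega)

lemma pathConcat_pathShift {n : ℕ} {a ω : ℕ → U} (h : ω ∈ pathCylinder n a) :
    pathConcat n a (pathShift n ω) = ω := by
  funext m
  unfold pathConcat pathShift
  split_ifs with hm
  · exact (h m hm.le).symm
  · congr 1
    omega

lemma pathCylinder_inter_preimage_pathShift {n m : ℕ} {a b : ℕ → U} (h : b 0 = a n) :
    pathCylinder n a ∩ pathShift n ⁻¹' pathCylinder m b
      = pathCylinder (n + m) (pathConcat n a b) := by
  ext ω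
  simp only [Set.mem_inter_iff, Set.mem_preimage, mem_pathCylinder, pathShift, pathConcat]
  constructor
  · rintro ⟨h1, h2⟩ i hi
    split_ifs with hin
    · exact h1 i hin.le
    · rw [← h2 (i - n) (by omega)]
      congr 1
      omega
  · intro h3
    refine ⟨fun i hi => ?_, fun i hi => ?_⟩
    · rcases hi.lt_or_eq with hlt | rfl
      · simpa [hlt] using h3 i (by omega)
      · simpa [h] using h3 i (by omega)
    · simpa using h3 (n + i) (by omega)

lemma pathCylinder_inter_preimage_pathShift_of_ne {n m : ℕ} {a b : ℕ → U} (h : b 0 ≠ a n) :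
    pathCylinder n a ∩ pathShift n ⁻¹' pathCylinder m b = ∅ := by
  refine Set.eq_empty_of_forall_notMem fun ω hω => h ?_
  rw [← hω.1 n le_rfl, ← hω.2 0 (Nat.zero_le _)]
  rfl

lemma isPiSystem_pathCylinder :
    IsPiSystem (Set.range fun p : ℕ × (ℕ → U) => pathCylinder p.1 p.2) := by
  rintro _ ⟨⟨n, a⟩, rfl⟩ _ ⟨⟨m, b⟩, rfl⟩ ⟨ω, h1, h2⟩
  refine ⟨⟨max n m, ω⟩, ?_⟩
  simp only [mem_pathCylinder] at h1 h2
  ext ζ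
  simp only [mem_pathCylinder, Set.mem_inter_iff]
  constructor
  · intro h
    exact ⟨fun i hi => (h i (hi.trans (le_max_left _ _))).trans (h1 i hi),
      fun i hi => (h i (hi.trans (le_max_right _ _))).trans (h2 i hi)⟩
  · rintro ⟨h3, h4⟩ i hi
    rcases le_max_iff.1 hi with hi | hi
    · exact (h3 i hi).trans (h1 i hi).symm
    · exact (h4 i hi).trans (h2 i hi).symm

variable [MeasurableSpace U]

@[fun_prop]
lemma measurable_pathShift (n : ℕ) : Measurable (pathShift n : (ℕ → U) → ℕ → U) := by
  unfold pathShift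
  fun_prop

@[fun_prop]
lemma measurable_pathConcat (n : ℕ) (a : ℕ → U) : Measurable (pathConcat n a) := by
  refine measurable_pi_lambda _ fun m => ?_
  unfold pathConcat
  split_ifs <;> fun_prop

variable [MeasurableSingletonClass U]

@[measurability]
lemma measurableSet_pathCylinder (n : ℕ) (a : ℕ → U) : MeasurableSet (pathCylinder n a) := by
  have : pathCylinder n a = ⋂ i ≤ n, (fun ω : ℕ → U => ω i) ⁻¹' {a i} := by
    ext ω
    simp [mem_pathCylinder]
  rw [this]
  exact .biInter (Set.to_countable _) fun i _ => measurable_pi_apply i (measurableSet_singleton _)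

variable [Countable U]

lemma generateFrom_pathCylinder :
    (MeasurableSpace.pi : MeasurableSpace (ℕ → U))
      = MeasurableSpace.generateFrom
          (Set.range fun p : ℕ × (ℕ → U) => pathCylinder p.1 p.2) := by
  apply le_antisymm
  · refine iSup_le fun n => ?_
    rintro _ ⟨s, -, rfl⟩
    let e : (Fin (n + 1) → U) → ℕ → U := fun p i => if h : i < n + 1 then p ⟨i, h⟩ else p 0
    have : (fun ω : ℕ → U => ω n) ⁻¹' s
        = ⋃ p ∈ {p : Fin (n + 1) → U | p (Fin.last n) ∈ s}, pathCylinder n (e p) := by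
      ext ω
      simp only [Set.mem_preimage, Set.mem_iUnion, Set.mem_ofPred_eq, exists_prop,
        mem_pathCylinder]
      constructor
      · intro h
        refine ⟨fun i => ω i, by simpa using h, fun i hi => ?_⟩
        simp only [e, dif_pos (Nat.lt_succ_of_le hi)]
      · rintro ⟨p, hp, h⟩
        rw [h n le_rfl]
        simp only [e, dif_pos n.lt_succ_self]
        exact hp
    rw [this]
    refine @MeasurableSet.biUnion _ _ (_) _ _ (Set.to_countable _) fun p _ => ?_
    exact MeasurableSpace.measurableSet_generateFrom ⟨(n, e p), rfl⟩
  · refine MeasurableSpace.generateFrom_le ?_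
    rintro _ ⟨p, rfl⟩
    exact measurableSet_pathCylinder _ _

lemma ext_of_pathCylinder {μ ν : Measure (ℕ → U)} [IsFiniteMeasure μ]
    (h : ∀ n a, μ (pathCylinder n a) = ν (pathCylinder n a)) (h_univ : μ Set.univ = ν Set.univ) :
    μ = ν := by
  refine ext_of_generate_finite _ generateFrom_pathCylinder isPiSystem_pathCylinder ?_ h_univ
  rintro _ ⟨p, rfl⟩
  exact h _ _

lemma tsum_measure_pathCylinder_zero (μ : Measure (ℕ → U)) :
    ∑' x, μ (pathCylinder 0 fun _ => x) = μ Set.univ := by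
  rw [← measure_iUnion _ fun x => measurableSet_pathCylinder _ _]
  · congr 1
    exact Set.eq_univ_of_forall fun ω => Set.mem_iUnion.2 ⟨ω 0, by simp [mem_pathCylinder]⟩
  · intro x y hxy
    refine Set.disjoint_left.2 fun ω h1 h2 => hxy ?_
    exact (h1 0 le_rfl).symm.trans (h2 0 le_rfl)

lemma tsum_measure_pathCylinder_succ (μ : Measure (ℕ → U)) (n : ℕ) (a : ℕ → U) :
    ∑' y, μ (pathCylinder (n + 1) (Function.update a (n + 1) y)) = μ (pathCylinder n a) := by
  rw [← measure_iUnion _ fun x => measurableSet_pathCylinder _ _]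
  · congr 1
    ext ω
    simp only [Set.mem_iUnion, mem_pathCylinder]
    constructor
    · rintro ⟨y, h⟩ i hi
      rw [h i (by omega), Function.update_of_ne (by omega)]
    · intro h
      refine ⟨ω (n + 1), fun i hi => ?_⟩
      rcases hi.lt_or_eq with hlt | rfl
      · rw [Function.update_of_ne (by omega), h i (by omega)]
      · simp
  · intro x y hxy
    refine Set.disjoint_left.2 fun ω h1 h2 => hxy ?_
    simpa using (h1 (n + 1) le_rfl).symm.trans (h2 (n + 1) le_rfl)

end Paths

section MarkovChains

variable {U : Type*} [MeasurableSpace U] {v : U → ℝ≥0∞} {P : U → U → ℝ≥0∞}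
  {μ : Measure (ℕ → U)}

lemma IsMarkovChain.measure_pathCylinder (h : IsMarkovChain v P μ) (n : ℕ) (a : ℕ → U) :
    μ (pathCylinder n a) = v (a 0) * ∏ i ∈ Finset.range n, P (a i) (a (i + 1)) :=
  h.2.2.2 n a

lemma IsMarkovChain.measure_pathCylinder_succ (h : IsMarkovChain v P μ) (n : ℕ) (a : ℕ → U) :
    μ (pathCylinder (n + 1) a) = μ (pathCylinder n a) * P (a n) (a (n + 1)) := by
  rw [h.measure_pathCylinder, h.measure_pathCylinder, Finset.prod_range_succ, mul_assoc]

lemma IsMarkovChain.ne_top (h : IsMarkovChain v P μ) (x y : U) : P x y ≠ ∞ :=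
  ENNReal.ne_top_of_tsum_ne_top (by rw [h.2.2.1 x]; exact ENNReal.one_ne_top) y

lemma IsMarkovChain.measure_pathCylinder_inter (h : IsMarkovChain v P μ) (n m : ℕ)
    (a b : ℕ → U) :
    μ (pathCylinder n a ∩ pathShift n ⁻¹' pathCylinder m b)
      = μ (pathCylinder n a) *
        if b 0 = a n then ∏ i ∈ Finset.range m, P (b i) (b (i + 1)) else 0 := by
  split_ifs with hb
  · rw [pathCylinder_inter_preimage_pathShift hb]
    induction m with
    | zero =>
      rw [Finset.prod_range_zero, mul_one, add_zero, pathCylinder_congr (b := a)]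
      intro i hi
      rcases hi.lt_or_eq with hlt | rfl
      · simp [pathConcat, hlt]
      · simp [pathConcat, hb]
    | succ m ih =>
      rw [← add_assoc, h.measure_pathCylinder_succ, ih, Finset.prod_range_succ, mul_assoc]
      simp [pathConcat, add_assoc]
  · rw [pathCylinder_inter_preimage_pathShift_of_ne hb, measure_empty, mul_zero]

variable [MeasurableSingletonClass U] [Countable U]

/-- The **Markov property**: given the path up to time `n`, the law of the future of a
time-homogeneous Markov chain depends only on the current state. -/
lemma IsMarkovChain.exists_future (h : IsMarkovChain v P μ) :
    ∃ L : U → Measure (ℕ → U), (∀ x, IsProbabilityMeasure (L x)) ∧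
      ∀ n a, (μ.restrict (pathCylinder n a)).map (pathShift n)
        = μ (pathCylinder n a) • L (a n) := by
  have := h.1
  let ρ : ℕ → (ℕ → U) → Measure (ℕ → U) := fun n a =>
    (μ (pathCylinder n a))⁻¹ • (μ.restrict (pathCylinder n a)).map (pathShift n)
  have hρ : ∀ n a, μ (pathCylinder n a) ≠ 0 → IsProbabilityMeasure (ρ n a) := fun n a h0 => by
    refine ⟨?_⟩
    rw [Measure.smul_apply, Measure.map_apply (by fun_prop) .univ, Set.preimage_univ,
      Measure.restrict_apply_univ, smul_eq_mul, ENNReal.inv_mul_cancel h0 (measure_ne_top _ _)]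
  have hρ_apply : ∀ n a, μ (pathCylinder n a) ≠ 0 → ∀ m b, ρ n a (pathCylinder m b)
      = if b 0 = a n then ∏ i ∈ Finset.range m, P (b i) (b (i + 1)) else 0 := by
    intro n a h0 m b
    rw [Measure.smul_apply, Measure.map_apply (by fun_prop) (measurableSet_pathCylinder _ _),
      Measure.restrict_apply (measurable_pathShift _ (measurableSet_pathCylinder _ _)),
      Set.inter_comm, h.measure_pathCylinder_inter, smul_eq_mul, ← mul_assoc,
      ENNReal.inv_mul_cancel h0 (measure_ne_top _ _), one_mul]
  let L : U → Measure (ℕ → U) := fun x =>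
    if hx : ∃ p : ℕ × (ℕ → U), p.2 p.1 = x ∧ μ (pathCylinder p.1 p.2) ≠ 0 then
      ρ hx.choose.1 hx.choose.2 else Measure.dirac fun _ => x
  refine ⟨L, fun x => ?_, fun n a => ?_⟩
  · by_cases hx : ∃ p : ℕ × (ℕ → U), p.2 p.1 = x ∧ μ (pathCylinder p.1 p.2) ≠ 0
    · simp only [L, dif_pos hx]
      exact hρ _ _ hx.choose_spec.2
    · simp only [L, dif_neg hx]
      infer_instance
  · by_cases h0 : μ (pathCylinder n a) = 0
    · rw [h0, zero_smul, Measure.restrict_eq_zero.2 h0, Measure.map_zero]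
    have hx : ∃ p : ℕ × (ℕ → U), p.2 p.1 = a n ∧ μ (pathCylinder p.1 p.2) ≠ 0 :=
      ⟨(n, a), rfl, h0⟩
    have hL : L (a n) = ρ n a := by
      simp only [L, dif_pos hx]
      have := hρ _ _ hx.choose_spec.2
      have := hρ n a h0
      refine ext_of_pathCylinder (fun m b => ?_) (by simp)
      rw [hρ_apply _ _ hx.choose_spec.2, hρ_apply n a h0, hx.choose_spec.1]
    rw [hL, smul_smul, ENNReal.mul_inv_cancel h0 (measure_ne_top _ _), one_smul]

/-- A path law whose cylinder probabilities are a product of transition weights times a function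
of the last state is a time-homogeneous Markov chain (a Doob transform of the weights). -/
lemma exists_isMarkovChain_of_weights [IsProbabilityMeasure μ] (w : U → ℝ≥0∞)
    (Q : U → U → ℝ≥0∞) (G : U → ℝ≥0∞)
    (h : ∀ n a, μ (pathCylinder n a)
      = (w (a 0) * ∏ i ∈ Finset.range n, Q (a i) (a (i + 1))) * G (a n)) :
    ∃ v P, IsMarkovChain v P μ := by
  let D : ℕ → (ℕ → U) → ℝ≥0∞ := fun n a =>
    w (a 0) * ∏ i ∈ Finset.range n, Q (a i) (a (i + 1))
  have hD : ∀ n a, μ (pathCylinder n a) = D n a * G (a n) := h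
  have hD_succ : ∀ n a, D (n + 1) a = D n a * Q (a n) (a (n + 1)) := fun n a => by
    simp only [D, Finset.prod_range_succ, mul_assoc]
  have hfin : ∀ n a, D n a * G (a n) ≠ ∞ := fun n a => hD n a ▸ measure_ne_top _ _
  let R : U → Prop := fun x => ∃ n a, a n = x ∧ μ (pathCylinder n a) ≠ 0
  have hG0 : ∀ x, R x → G x ≠ 0 := by
    rintro _ ⟨n, a, rfl, h0⟩ hG
    exact h0 (by rw [hD, hG, mul_zero])
  have hGtop : ∀ x, R x → G x ≠ ∞ := by
    rintro _ ⟨n, a, rfl, h0⟩ hG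
    rw [hD] at h0
    refine hfin n a ?_
    rw [hG, ENNReal.mul_top (left_ne_zero_of_mul h0)]
  have hQG : ∀ x, R x → ∑' y, Q x y * G y = G x := by
    rintro _ ⟨n, a, rfl, h0⟩
    rw [hD] at h0
    have hD0 : D n a ≠ 0 := left_ne_zero_of_mul h0
    have hDtop : D n a ≠ ∞ := fun hD' => hfin n a (by
      rw [hD', ENNReal.top_mul (right_ne_zero_of_mul h0)])
    refine (ENNReal.mul_right_inj hD0 hDtop).1 ?_
    rw [← hD n a, ← tsum_measure_pathCylinder_succ, ← ENNReal.tsum_mul_left]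
    refine tsum_congr fun y => ?_
    have hDu : D n (Function.update a (n + 1) y) = D n a := by
      simp only [D]
      congr 1
      refine Finset.prod_congr rfl fun i hi => ?_
      have := Finset.mem_range.1 hi
      rw [Function.update_of_ne (by omega), Function.update_of_ne (by omega)]
    rw [hD, hD_succ, hDu, Function.update_self, Function.update_of_ne (by omega)]
    exact (mul_assoc (D n a) _ _).symm
  refine ⟨fun x => w x * G x,
    fun x y => if R x then Q x y * G y / G x else if y = x then 1 else 0,
    inferInstance, ?_, fun x => ?_, fun n a => ?_⟩
  · rw [IsProbVec, ← measure_univ (μ := μ), ← tsum_measure_pathCylinder_zero]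
    exact tsum_congr fun x => by simp [hD, D]
  · by_cases hx : R x
    · simp only [if_pos hx, div_eq_mul_inv]
      rw [ENNReal.tsum_mul_right, hQG x hx, ENNReal.mul_inv_cancel (hG0 x hx) (hGtop x hx)]
    · simp [if_neg hx]
  · change μ (pathCylinder n a) = _
    induction n with
    | zero => simp [hD, D]
    | succ n ih =>
      rw [Finset.prod_range_succ, ← mul_assoc, ← ih]
      by_cases h0 : μ (pathCylinder n a) = 0
      · rw [h0, zero_mul]
        exact measure_mono_null (pathCylinder_succ_subset n a) h0
      · have hR : R (a n) := ⟨n, a, rfl, h0⟩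
        simp only [if_pos hR]
        rw [hD, hD_succ, hD, div_eq_mul_inv]
        calc D n a * Q (a n) (a (n + 1)) * G (a (n + 1))
            = (G (a n) * (G (a n))⁻¹) * (D n a * Q (a n) (a (n + 1)) * G (a (n + 1))) := by
              rw [ENNReal.mul_inv_cancel (hG0 _ hR) (hGtop _ hR), one_mul]
          _ = _ := by ring

end MarkovChains

section HiddenMarkov

/-- Apply `f` at every time along a path. -/
def pathMap {U V : Type*} (f : U → V) (ω : ℕ → U) : ℕ → V := fun n => f (ω n)

lemma pathMap_mem_pathCylinder {U V : Type*} (f : U → V) {n : ℕ} {a ω : ℕ → U}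
    (h : ω ∈ pathCylinder n a) : pathMap f ω ∈ pathCylinder n (pathMap f a) :=
  fun i hi => congrArg f (h i hi)

@[fun_prop]
lemma measurable_pathMap {U V : Type*} [MeasurableSpace U] [MeasurableSpace V] {f : U → V}
    (hf : Measurable f) : Measurable (pathMap f) :=
  measurable_pi_lambda _ fun n => hf.comp (measurable_pi_apply n)

variable {A C : Type*} [MeasurableSpace A] [MeasurableSpace C] {f : A → C}
  {μX : Measure (ℕ → A)} {μZ : Measure (ℕ → C)} {κ : Kernel (ℕ → C) (ℕ → A)}
  {LX : A → Measure (ℕ → A)} {LZ : C → Measure (ℕ → C)}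

/-- The density of the image under `f` of the future started from `x`, relative to the future of
the image chain started from `f x`. -/
noncomputable def futureDensity (f : A → C) (LX : A → Measure (ℕ → A))
    (LZ : C → Measure (ℕ → C)) (x : A) : (ℕ → C) → ℝ≥0∞ :=
  ((LX x).map (pathMap f)).rnDeriv (LZ (f x))

@[fun_prop]
lemma measurable_futureDensity (x : A) : Measurable (futureDensity f LX LZ x) :=
  Measure.measurable_rnDeriv _ _

variable [Countable A] [MeasurableSingletonClass A]

lemma exists_conditional_law [IsProbabilityMeasure μX] (hf : μX.map (pathMap f) = μZ) :
    ∃ κ : Kernel (ℕ → C) (ℕ → A), IsMarkovKernel κ ∧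
      μZ ⊗ₘ κ = μX.map fun ω => (pathMap f ω, ω) := by
  have : Nonempty (ℕ → A) := nonempty_of_isProbabilityMeasure μX
  refine ⟨condDistrib id (pathMap f) μX, inferInstance, ?_⟩
  rw [← hf]
  exact compProd_map_condDistrib aemeasurable_id

lemma setLIntegral_conditional_law [SFinite μZ] [IsSFiniteKernel κ]
    (hκ : μZ ⊗ₘ κ = μX.map fun ω => (pathMap f ω, ω)) {S : Set (ℕ → C)} (hS : MeasurableSet S)
    {E : Set (ℕ → A)} (hE : MeasurableSet E) :
    ∫⁻ ζ in S, κ ζ E ∂μZ = μX (pathMap f ⁻¹' S ∩ E) := by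
  have hfm : Measurable f := measurable_of_countable f
  rw [← Measure.compProd_apply_prod hS hE, hκ, Measure.map_apply (by fun_prop) (hS.prod hE)]
  rfl

variable [MeasurableSingletonClass C]

lemma measure_pathCylinder_le (hf : μX.map (pathMap f) = μZ) (n : ℕ) (a : ℕ → A) :
    μX (pathCylinder n a) ≤ μZ (pathCylinder n (pathMap f a)) := by
  have hfm : Measurable f := measurable_of_countable f
  rw [← hf, Measure.map_apply (by fun_prop) (measurableSet_pathCylinder _ _)]
  exact measure_mono fun ω hω => pathMap_mem_pathCylinder f hω

lemma map_future_absolutelyContinuous [IsFiniteMeasure μX]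
    (hf : μX.map (pathMap f) = μZ) {n : ℕ} {a : ℕ → A}
    (hLX : (μX.restrict (pathCylinder n a)).map (pathShift n) = μX (pathCylinder n a) • LX (a n))
    (hLZ : (μZ.restrict (pathCylinder n (pathMap f a))).map (pathShift n)
      = μZ (pathCylinder n (pathMap f a)) • LZ (f (a n)))
    (h0 : μX (pathCylinder n a) ≠ 0) :
    (LX (a n)).map (pathMap f) ≪ LZ (f (a n)) := by
  have hfm : Measurable f := measurable_of_countable f
  intro S hS
  obtain ⟨S', hSS', hS'm, hS'0⟩ := exists_measurable_superset_of_null hS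
  refine measure_mono_null hSS' ?_
  have hZ0 : μZ (pathCylinder n (pathMap f a) ∩ pathShift n ⁻¹' S') = 0 := by
    have := congrArg (fun m => m S') hLZ
    rwa [Measure.map_apply (by fun_prop) hS'm, Measure.restrict_apply
      (measurable_pathShift n hS'm), Set.inter_comm, Measure.smul_apply, hS'0, smul_zero] at this
  have hX0 : μX (pathCylinder n a) * LX (a n) (pathMap f ⁻¹' S') = 0 := by
    have hm : MeasurableSet (pathMap f ⁻¹' S') := measurable_pathMap hfm hS'm
    have := congrArg (fun m => m (pathMap f ⁻¹' S')) hLX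
    rw [Measure.map_apply (by fun_prop) hm, Measure.restrict_apply
      (measurable_pathShift n hm), Measure.smul_apply, smul_eq_mul] at this
    rw [← this]
    rw [← hf, Measure.map_apply (by fun_prop) ((measurableSet_pathCylinder _ _).inter
      (measurable_pathShift n hS'm))] at hZ0
    refine measure_mono_null ?_ hZ0
    intro ω hω
    exact ⟨pathMap_mem_pathCylinder f hω.2, hω.1⟩
  rw [Measure.map_apply (by fun_prop) hS'm]
  exact (mul_eq_zero.1 hX0).resolve_left h0

/-- Given the whole image path, the conditional probability of a cylinder is an explicit function
of the image path up to the final time and of the density of the image of the future. -/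
lemma conditional_law_pathCylinder_ae_eq [IsFiniteMeasure μX] [IsFiniteMeasure μZ]
    [IsSFiniteKernel κ] [∀ x, IsProbabilityMeasure (LX x)] [∀ z, IsProbabilityMeasure (LZ z)]
    (hf : μX.map (pathMap f) = μZ) (hκ : μZ ⊗ₘ κ = μX.map fun ω => (pathMap f ω, ω))
    {n : ℕ} {a : ℕ → A}
    (hLX : (μX.restrict (pathCylinder n a)).map (pathShift n) = μX (pathCylinder n a) • LX (a n))
    (hLZ : (μZ.restrict (pathCylinder n (pathMap f a))).map (pathShift n)
      = μZ (pathCylinder n (pathMap f a)) • LZ (f (a n))) :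
    (fun ζ => κ ζ (pathCylinder n a)) =ᵐ[μZ] (pathCylinder n (pathMap f a)).indicator fun ζ =>
      μX (pathCylinder n a) / μZ (pathCylinder n (pathMap f a)) *
        futureDensity f LX LZ (a n) (pathShift n ζ) := by
  have hfm : Measurable f := measurable_of_countable f
  have hcm := measurableSet_pathCylinder n (pathMap f a)
  have ham := measurableSet_pathCylinder n a
  refine ae_eq_of_forall_setLIntegral_eq_of_sigmaFinite (κ.measurable_coe ham)
    (Measurable.indicator (by fun_prop) hcm) fun S hS _ => ?_
  rw [setLIntegral_conditional_law hκ hS ham, setLIntegral_indicator hcm]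
  by_cases h0 : μX (pathCylinder n a) = 0
  · rw [measure_mono_null Set.inter_subset_right h0]
    simp [h0]
  have hZ0 : μZ (pathCylinder n (pathMap f a)) ≠ 0 := fun h =>
    h0 (le_antisymm ((measure_pathCylinder_le hf n a).trans h.le) zero_le)
  have hac := map_future_absolutelyContinuous hf hLX hLZ h0
  set c := pathMap f a with hc
  have hTm : MeasurableSet (pathConcat n c ⁻¹' S) := measurable_pathConcat n c hS
  rw [lintegral_const_mul _ (by fun_prop)]
  have key : ∫⁻ ζ in pathCylinder n c ∩ S, futureDensity f LX LZ (a n) (pathShift n ζ) ∂μZ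
      = μZ (pathCylinder n c) * LX (a n) (pathMap f ⁻¹' (pathConcat n c ⁻¹' S)) := by
    have hset : pathCylinder n c ∩ S
        = pathShift n ⁻¹' (pathConcat n c ⁻¹' S) ∩ pathCylinder n c := by
      ext ζ
      simp only [Set.mem_inter_iff, Set.mem_preimage]
      constructor
      · rintro ⟨h1, h2⟩
        exact ⟨by rwa [pathConcat_pathShift h1], h1⟩
      · rintro ⟨h1, h2⟩
        exact ⟨h2, by rwa [pathConcat_pathShift h2] at h1⟩
    rw [hset, ← Measure.restrict_restrict (measurable_pathShift n hTm),
      ← setLIntegral_map hTm (by fun_prop) (by fun_prop), hLZ, Measure.restrict_smul,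
      lintegral_smul_measure, futureDensity, Measure.setLIntegral_rnDeriv hac,
      Measure.map_apply (by fun_prop) hTm, smul_eq_mul]
  rw [key, ← mul_assoc, ENNReal.div_mul_cancel hZ0 (measure_ne_top _ _)]
  have hEm : MeasurableSet (pathMap f ⁻¹' (pathConcat n c ⁻¹' S)) := measurable_pathMap hfm hTm
  rw [← smul_eq_mul, ← Measure.smul_apply, ← hLX, Measure.map_apply (by fun_prop) hEm,
    Measure.restrict_apply (measurable_pathShift n hEm)]
  congr 1
  ext ω
  simp only [Set.mem_inter_iff, Set.mem_preimage, and_congr_left_iff]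
  intro hω
  have : pathConcat n c (pathMap f (pathShift n ω)) = pathMap f ω :=
    pathConcat_pathShift (pathMap_mem_pathCylinder f hω)
  rw [this]

variable [Countable C]

lemma ae_conditional_law_pathMap_eq [SFinite μZ] [IsSFiniteKernel κ]
    (hκ : μZ ⊗ₘ κ = μX.map fun ω => (pathMap f ω, ω)) :
    ∀ᵐ ζ ∂μZ, ∀ᵐ ω ∂κ ζ, pathMap f ω = ζ := by
  have hfm : Measurable f := measurable_of_countable f
  refine Measure.ae_ae_of_ae_compProd (p := fun p => pathMap f p.2 = p.1) ?_
  rw [hκ, ae_map_iff (by fun_prop) (measurableSet_eq_fun (by fun_prop) (by fun_prop))]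
  exact ae_of_all _ fun ω => rfl

end HiddenMarkov

section Coupling

variable {ι : Type*} [Fintype ι] {A : ι → Type*} [∀ i, MeasurableSpace (A i)]
  {C : Type*} [MeasurableSpace C] {μZ : Measure (ℕ → C)}

lemma measurable_pi_kernel {T : Type*} [MeasurableSpace T] {Ω : ι → Type*}
    [∀ i, MeasurableSpace (Ω i)] (κ : ∀ i, Kernel T (Ω i)) [∀ i, IsMarkovKernel (κ i)] :
    Measurable fun t => Measure.pi fun i => κ i t := by
  refine Measurable.measure_of_isPiSystem_of_isProbabilityMeasure generateFrom_pi.symm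
    isPiSystem_pi ?_
  rintro _ ⟨s, hs, rfl⟩
  simp_rw [Measure.pi_pi]
  exact Finset.measurable_prod _ fun i _ => (κ i).measurable_coe (hs i trivial)

/-- The kernel given by the product of finitely many Markov kernels. -/
noncomputable def piKernel {T : Type*} [MeasurableSpace T] {Ω : ι → Type*}
    [∀ i, MeasurableSpace (Ω i)] (κ : ∀ i, Kernel T (Ω i)) [∀ i, IsMarkovKernel (κ i)] :
    Kernel T (∀ i, Ω i) :=
  ⟨fun t => Measure.pi fun i => κ i t, measurable_pi_kernel κ⟩

lemma piKernel_apply {T : Type*} [MeasurableSpace T] {Ω : ι → Type*}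
    [∀ i, MeasurableSpace (Ω i)] (κ : ∀ i, Kernel T (Ω i)) [∀ i, IsMarkovKernel (κ i)] (t : T) :
    piKernel κ t = Measure.pi fun i => κ i t := rfl

instance {T : Type*} [MeasurableSpace T] {Ω : ι → Type*}
    [∀ i, MeasurableSpace (Ω i)] (κ : ∀ i, Kernel T (Ω i)) [∀ i, IsMarkovKernel (κ i)] :
    IsMarkovKernel (piKernel κ) :=
  ⟨fun t => by rw [piKernel_apply]; infer_instance⟩

/-- The path in the product space whose coordinates are the given paths. -/
def pathTuple {U : ι → Type*} (x : ∀ i, ℕ → U i) : ℕ → ∀ i, U i := fun n i => x i n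

omit [Fintype ι] in
@[fun_prop]
lemma measurable_pathTuple : Measurable (pathTuple : (∀ i, ℕ → A i) → ℕ → ∀ i, A i) := by
  unfold pathTuple
  fun_prop

/-- Draw an image path from `μZ`, and then the coordinate paths independently from `κ`. -/
noncomputable def couplingMeasure (μZ : Measure (ℕ → C)) (κ : ∀ i, Kernel (ℕ → C) (ℕ → A i))
    [∀ i, IsMarkovKernel (κ i)] : Measure (ℕ → ∀ i, A i) :=
  (μZ ⊗ₘ piKernel κ).map fun p => pathTuple p.2

variable {κ : ∀ i, Kernel (ℕ → C) (ℕ → A i)} [∀ i, IsMarkovKernel (κ i)]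
  [IsProbabilityMeasure μZ]

instance : IsProbabilityMeasure (couplingMeasure μZ κ) :=
  Measure.isProbabilityMeasure_map (by fun_prop)

lemma couplingMeasure_setOf_forall_mem {E : ∀ i, Set (ℕ → A i)}
    (hE : ∀ i, MeasurableSet (E i)) :
    couplingMeasure μZ κ {ω | ∀ i, (fun n => ω n i) ∈ E i} = ∫⁻ ζ, ∏ i, κ i ζ (E i) ∂μZ := by
  have hset : (fun p : (ℕ → C) × (∀ i, ℕ → A i) => pathTuple p.2) ⁻¹'
      {ω | ∀ i, (fun n => ω n i) ∈ E i} = Set.univ ×ˢ Set.univ.pi E := by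
    ext p
    simp [pathTuple]
  have hm : MeasurableSet {ω : ℕ → ∀ i, A i | ∀ i, (fun n => ω n i) ∈ E i} := by
    have : {ω : ℕ → ∀ i, A i | ∀ i, (fun n => ω n i) ∈ E i}
        = ⋂ i, (fun (ω : ℕ → ∀ i, A i) n => ω n i) ⁻¹' E i := by
      ext ω
      simp
    rw [this]
    exact .iInter fun i =>
      measurable_pi_lambda _ (fun n => (measurable_pi_apply i).comp (measurable_pi_apply n)) (hE i)
  rw [couplingMeasure, Measure.map_apply (by fun_prop) hm, hset,
    Measure.compProd_apply_prod .univ (.univ_pi hE), setLIntegral_univ]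
  simp_rw [piKernel_apply, Measure.pi_pi]

variable {f : ∀ i, A i → C} {μX : ∀ i, Measure (ℕ → A i)}

section

variable [∀ i, Countable (A i)] [∀ i, MeasurableSingletonClass (A i)]

lemma couplingMeasure_map_eval
    (hκ : ∀ i, μZ ⊗ₘ κ i = (μX i).map fun ω => (pathMap (f i) ω, ω)) (i : ι) :
    (couplingMeasure μZ κ).map (fun ω n => ω n i) = μX i := by
  have hm : Measurable fun (ω : ℕ → ∀ i, A i) n => ω n i := by fun_prop
  ext S hS
  have h := couplingMeasure_setOf_forall_mem (μZ := μZ) (κ := κ)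
    (E := Function.update (fun _ => Set.univ) i S) (fun j => by
      rcases eq_or_ne j i with rfl | hj
      · simpa using hS
      · simp [hj])
  rw [Measure.map_apply hm hS]
  have hset : {ω : ℕ → ∀ i, A i | ∀ j, (fun n => ω n j) ∈
      (Function.update (fun _ => Set.univ) i S : ∀ j, Set (ℕ → A j)) j}
      = (fun (ω : ℕ → ∀ i, A i) n => ω n i) ⁻¹' S := by
    ext ω
    simp only [Set.mem_ofPred_eq, Set.mem_preimage]
    constructor
    · intro h
      simpa using h i
    · intro h j
      rcases eq_or_ne j i with rfl | hj
      · simpa using h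
      · simp [hj]
  rw [hset] at h
  have := setLIntegral_conditional_law (hκ i) .univ hS
  rw [setLIntegral_univ, Set.preimage_univ, Set.univ_inter] at this
  rw [h, ← this]
  refine lintegral_congr fun ζ => ?_
  rw [Finset.prod_eq_single i]
  · simp
  · intro j _ hj
    simp [hj]
  · simp

variable [Countable C] [MeasurableSingletonClass C]

lemma ae_pi_pathMap_eq
    (hκ : ∀ i, μZ ⊗ₘ κ i = (μX i).map fun ω => (pathMap (f i) ω, ω)) :
    ∀ᵐ p ∂μZ ⊗ₘ piKernel κ, ∀ i, pathMap (f i) (p.2 i) = p.1 := by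
  have hfm : ∀ i, Measurable (f i) := fun i => measurable_of_countable (f i)
  refine ae_all_iff.2 fun i => ?_
  refine (Measure.ae_compProd_iff
    (measurableSet_eq_fun ((measurable_pathMap (hfm i)).comp (by fun_prop)) (by fun_prop))).2 ?_
  filter_upwards [ae_conditional_law_pathMap_eq (hκ i)] with ζ hζ
  rw [piKernel_apply]
  exact (measurePreserving_eval (fun i => κ i ζ) i).quasiMeasurePreserving.ae hζ

lemma ae_couplingMeasure_eq
    (hκ : ∀ i, μZ ⊗ₘ κ i = (μX i).map fun ω => (pathMap (f i) ω, ω)) :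
    ∀ᵐ ω ∂couplingMeasure μZ κ, ∀ (i j : ι) (t : ℕ), f i (ω t i) = f j (ω t j) := by
  have hfm : ∀ i, Measurable (f i) := fun i => measurable_of_countable (f i)
  simp_rw [ae_all_iff]
  intro i j t
  rw [couplingMeasure, ae_map_iff (by fun_prop)
    (measurableSet_eq_fun (f := fun ω : ℕ → ∀ i, A i => f i (ω t i))
      (g := fun ω => f j (ω t j)) ((hfm i).comp (by fun_prop)) ((hfm j).comp (by fun_prop)))]
  filter_upwards [ae_pi_pathMap_eq hκ] with p hp
  exact congrFun ((hp i).trans (hp j).symm) t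

lemma couplingMeasure_inter
    (hκ : ∀ i, μZ ⊗ₘ κ i = (μX i).map fun ω => (pathMap (f i) ω, ω)) (i₀ : ι) {s : Finset ι}
    {T : ∀ i, Set (ℕ → A i)} (hT : ∀ i ∈ s, MeasurableSet (T i))
    {S : Set (ℕ → C)} (hS : MeasurableSet S) :
    couplingMeasure μZ κ ((⋂ i ∈ s, (fun (ω : ℕ → ∀ i, A i) n => ω n i) ⁻¹' T i) ∩
        (fun (ω : ℕ → ∀ i, A i) n => f i₀ (ω n i₀)) ⁻¹' S)
      = ∫⁻ ζ in S, ∏ i ∈ s, κ i ζ (T i) ∂μZ := by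
  have hfm : ∀ i, Measurable (f i) := fun i => measurable_of_countable (f i)
  have hm : ∀ i, Measurable fun (ω : ℕ → ∀ i, A i) n => ω n i := fun i => by fun_prop
  have hmZ : Measurable fun (ω : ℕ → ∀ i, A i) n => f i₀ (ω n i₀) :=
    (measurable_pathMap (hfm i₀)).comp (hm i₀)
  let E : ∀ i, Set (ℕ → A i) := fun i => if i ∈ s then T i else Set.univ
  have hE : ∀ i, MeasurableSet (E i) := fun i => by
    by_cases hi : i ∈ s
    · simpa [E, hi] using hT i hi
    · simp [E, hi]
  rw [couplingMeasure, Measure.map_apply (by fun_prop)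
    ((Finset.measurableSet_biInter s fun i hi => hm i (hT i hi)).inter (hmZ hS))]
  have hae : ((fun p : (ℕ → C) × (∀ i, ℕ → A i) => pathTuple p.2) ⁻¹'
      ((⋂ i ∈ s, (fun (ω : ℕ → ∀ i, A i) n => ω n i) ⁻¹' T i) ∩
        (fun (ω : ℕ → ∀ i, A i) n => f i₀ (ω n i₀)) ⁻¹' S) : Set _)
      =ᵐ[μZ ⊗ₘ piKernel κ] (S ×ˢ Set.univ.pi E : Set _) := by
    rw [eventuallyEq_set]
    filter_upwards [ae_pi_pathMap_eq hκ] with p hp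
    have hp' : (fun n => f i₀ (pathTuple p.2 n i₀)) = p.1 := hp i₀
    have hEi : ∀ i, p.2 i ∈ E i ↔ (i ∈ s → p.2 i ∈ T i) := fun i => by
      by_cases hi : i ∈ s <;> simp [E, hi]
    simp only [Set.mem_preimage, Set.mem_inter_iff, Set.mem_iInter, hp', Set.mem_prod,
      Set.mem_univ_pi, hEi]
    exact and_comm
  rw [measure_congr hae, Measure.compProd_apply_prod hS (.univ_pi hE)]
  refine lintegral_congr fun ζ => ?_
  rw [piKernel_apply, Measure.pi_pi, ← Finset.prod_subset s.subset_univ (f := fun i => κ i ζ (E i))]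
  · exact Finset.prod_congr rfl fun i hi => by simp [E, hi]
  · intro i _ hi
    simp [E, hi]

lemma couplingMeasure_map_image
    (hκ : ∀ i, μZ ⊗ₘ κ i = (μX i).map fun ω => (pathMap (f i) ω, ω)) (i₀ : ι) :
    (couplingMeasure μZ κ).map (fun ω n => f i₀ (ω n i₀)) = μZ := by
  have hmZ : Measurable fun (ω : ℕ → ∀ i, A i) n => f i₀ (ω n i₀) :=
    (measurable_pathMap (measurable_of_countable (f i₀))).comp
      (f := fun (ω : ℕ → ∀ i, A i) n => ω n i₀) (by fun_prop)
  ext S hS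
  rw [Measure.map_apply hmZ hS]
  simpa using couplingMeasure_inter hκ i₀ (s := ∅) (T := fun _ => Set.univ) (by simp) hS

lemma condExp_couplingMeasure_indic
    (hκ : ∀ i, μZ ⊗ₘ κ i = (μX i).map fun ω => (pathMap (f i) ω, ω)) (i₀ : ι) {s : Finset ι}
    {T : ∀ i, Set (ℕ → A i)} (hT : ∀ i ∈ s, MeasurableSet (T i)) :
    (couplingMeasure μZ κ)[indic (⋂ i ∈ s, (fun (ω : ℕ → ∀ i, A i) n => ω n i) ⁻¹' T i) |
        MeasurableSpace.comap (fun (ω : ℕ → ∀ i, A i) n => f i₀ (ω n i₀)) inferInstance]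
      =ᵐ[couplingMeasure μZ κ]
        fun ω => (∏ i ∈ s, κ i (fun n => f i₀ (ω n i₀)) (T i)).toReal := by
  set Z : (ℕ → ∀ i, A i) → ℕ → C := fun ω n => f i₀ (ω n i₀) with hZ
  have hm : ∀ i, Measurable fun (ω : ℕ → ∀ i, A i) n => ω n i := fun i => by fun_prop
  have hZm : Measurable Z :=
    (measurable_pathMap (measurable_of_countable (f i₀))).comp (hm i₀)
  have hTm : MeasurableSet (⋂ i ∈ s, (fun (ω : ℕ → ∀ i, A i) n => ω n i) ⁻¹' T i) :=
    Finset.measurableSet_biInter s fun i hi => hm i (hT i hi)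
  have hφm : Measurable fun ζ => ∏ i ∈ s, κ i ζ (T i) :=
    Finset.measurable_prod _ fun i hi => (κ i).measurable_coe (hT i hi)
  have hφle : ∀ ζ, ∏ i ∈ s, κ i ζ (T i) ≤ 1 := fun ζ =>
    Finset.prod_le_one' fun i _ => prob_le_one
  symm
  refine ae_eq_condExp_of_forall_setIntegral_eq hZm.comap_le ?_ ?_ ?_ ?_
  · exact (integrable_const 1).indicator hTm
  · intro B _ _
    refine Integrable.integrableOn (Integrable.of_bound (C := 1)
      (hφm.comp hZm).ennreal_toReal.aestronglyMeasurable (ae_of_all _ fun ω => ?_))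
    rw [Real.norm_of_nonneg ENNReal.toReal_nonneg]
    exact ENNReal.toReal_le_of_le_ofReal zero_le_one (by simpa using hφle _)
  · rintro _ ⟨S, hS, rfl⟩ _
    rw [indic, setIntegral_indicator hTm, setIntegral_const, smul_eq_mul, mul_one,
      Measure.real, Set.inter_comm, couplingMeasure_inter hκ i₀ hT hS,
      ← integral_toReal hφm.aemeasurable.restrict
        (ae_of_all _ fun ζ => (hφle ζ).trans_lt ENNReal.one_lt_top)]
    rw [← setIntegral_map (f := fun ζ => (∏ i ∈ s, κ i ζ (T i)).toReal) hS
      hφm.ennreal_toReal.aestronglyMeasurable hZm.aemeasurable, couplingMeasure_map_image hκ i₀]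
  · exact (hφm.ennreal_toReal.comp (comap_measurable Z)).aestronglyMeasurable

lemma iCondIndepGiven_couplingMeasure
    (hκ : ∀ i, μZ ⊗ₘ κ i = (μX i).map fun ω => (pathMap (f i) ω, ω)) (i₀ : ι) :
    iCondIndepGiven (couplingMeasure μZ κ) (fun ω n => f i₀ (ω n i₀)) (fun i ω n => ω n i) := by
  intro s t ht
  choose! T hT hTt using ht
  have hst : ⋂ i ∈ s, t i = ⋂ i ∈ s, (fun (ω : ℕ → ∀ i, A i) n => ω n i) ⁻¹' T i :=
    Set.iInter₂_congr fun i hi => (hTt i hi).symm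
  have hfactor : ∀ᵐ ω ∂couplingMeasure μZ κ, ∀ i ∈ s,
      ((couplingMeasure μZ κ)[indic (t i) |
        MeasurableSpace.comap (fun (ω : ℕ → ∀ i, A i) n => f i₀ (ω n i₀)) inferInstance]) ω
        = (κ i (fun n => f i₀ (ω n i₀)) (T i)).toReal := by
    refine (Finset.eventually_all s).2 fun i hi => ?_
    have := condExp_couplingMeasure_indic hκ i₀ (s := {i}) (T := T)
      (by simpa using hT i hi)
    simp only [Finset.mem_singleton, Set.iInter_iInter_eq_left, hTt i hi,
      Finset.prod_singleton] at this
    exact this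
  rw [hst]
  filter_upwards [condExp_couplingMeasure_indic hκ i₀ hT, hfactor] with ω h1 h2
  rw [h1, Finset.prod_apply, ENNReal.toReal_prod]
  exact (Finset.prod_congr rfl h2).symm

/-- The coupling of hidden Markov chains that are conditionally independent given their common
Markov image is itself a time-homogeneous Markov chain. -/
lemma exists_isMarkovChain_couplingMeasure {αX : ∀ i, A i → ℝ≥0∞} {PX : ∀ i, A i → A i → ℝ≥0∞}
    {αZ : C → ℝ≥0∞} {PZ : C → C → ℝ≥0∞}
    (hX : ∀ i, IsMarkovChain (αX i) (PX i) (μX i)) (hZ : IsMarkovChain αZ PZ μZ)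
    (hf : ∀ i, (μX i).map (pathMap (f i)) = μZ)
    (hκ : ∀ i, μZ ⊗ₘ κ i = (μX i).map fun ω => (pathMap (f i) ω, ω)) (i₀ : ι) :
    ∃ v P, IsMarkovChain v P (couplingMeasure μZ κ) := by
  have := fun i => (hX i).1
  choose LX hLX_prob hLX using fun i => (hX i).exists_future
  obtain ⟨LZ, hLZ_prob, hLZ⟩ := hZ.exists_future
  let z : (∀ i, A i) → C := fun x => f i₀ (x i₀)
  let e : (∀ i, A i) → ℝ≥0∞ := fun x => if ∀ i, f i (x i) = z x then 1 else 0
  let G : (∀ i, A i) → ℝ≥0∞ := fun x =>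
    ∫⁻ ζ, ∏ i, futureDensity (f i) (LX i) LZ (x i) ζ ∂LZ (z x)
  let r : ℕ → (ℕ → ∀ i, A i) → ι → ℝ≥0∞ := fun n a i =>
    μX i (pathCylinder n fun m => a m i) / μZ (pathCylinder n (pathMap z a))
  refine exists_isMarkovChain_of_weights
    (fun x => e x * ((∏ i, αX i (x i) / αZ (z x)) * αZ (z x)))
    (fun x y => e y * ((∏ i, PX i (x i) (y i) / PZ (z x) (z y)) * PZ (z x) (z y))) G
    fun n a => ?_
  have hweight : e (a 0) * ((∏ i, αX i (a 0 i) / αZ (z (a 0))) * αZ (z (a 0))) *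
      ∏ m ∈ Finset.range n, e (a (m + 1)) *
        ((∏ i, PX i (a m i) (a (m + 1) i) / PZ (z (a m)) (z (a (m + 1)))) *
          PZ (z (a m)) (z (a (m + 1))))
      = (∏ m ∈ Finset.range (n + 1), e (a m)) *
        ((∏ i, r n a i) * μZ (pathCylinder n (pathMap z a))) := by
    induction n with
    | zero => simp [r, (hX _).measure_pathCylinder, hZ.measure_pathCylinder, pathMap]
    | succ n ih =>
      have hr : ∀ i, r (n + 1) a i
          = r n a i * (PX i (a n i) (a (n + 1) i) / PZ (z (a n)) (z (a (n + 1)))) := fun i => by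
        simp only [r]
        rw [(hX i).measure_pathCylinder_succ, hZ.measure_pathCylinder_succ]
        exact ENNReal.mul_div_mul_comm (.inr (hZ.ne_top _ _)) (.inl (measure_ne_top _ _))
      rw [Finset.prod_range_succ, ← mul_assoc, ih, Finset.prod_range_succ _ (n + 1)]
      simp_rw [hr]
      rw [Finset.prod_mul_distrib, hZ.measure_pathCylinder_succ]
      simp only [pathMap]
      ring
  have hcyl : pathCylinder n a
      = {ω | ∀ i, (fun m => ω m i) ∈ pathCylinder n fun m => a m i} := by
    ext ω
    simp only [mem_pathCylinder, Set.mem_ofPred_eq, funext_iff]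
    exact ⟨fun h i m hm => h m hm i, fun h m hm i => h i m hm⟩
  have hae : ∀ᵐ ζ ∂μZ, ∀ i, κ i ζ (pathCylinder n fun m => a m i)
      = (pathCylinder n (pathMap (f i) fun m => a m i)).indicator (fun ζ =>
        μX i (pathCylinder n fun m => a m i) /
          μZ (pathCylinder n (pathMap (f i) fun m => a m i)) *
          futureDensity (f i) (LX i) LZ (a n i) (pathShift n ζ)) ζ :=
    ae_all_iff.2 fun i => conditional_law_pathCylinder_ae_eq (hf i) (hκ i)
      (hLX i n fun m => a m i) (hLZ n _)
  rw [hweight, hcyl, couplingMeasure_setOf_forall_mem fun i => measurableSet_pathCylinder _ _]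
  by_cases hagree : ∀ m ≤ n, ∀ i, f i (a m i) = z (a m)
  · have he : ∏ m ∈ Finset.range (n + 1), e (a m) = 1 := Finset.prod_eq_one fun m hm =>
      if_pos (hagree m (Nat.lt_succ_iff.1 (Finset.mem_range.1 hm)))
    have hc : ∀ i, pathCylinder n (pathMap (f i) fun m => a m i)
        = pathCylinder n (pathMap z a) := fun i =>
      pathCylinder_congr fun m hm => hagree m hm i
    simp_rw [hc] at hae
    have hint : (fun ζ => ∏ i, κ i ζ (pathCylinder n fun m => a m i)) =ᵐ[μZ]
        (pathCylinder n (pathMap z a)).indicator fun ζ => (∏ i, r n a i) *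
          ∏ i, futureDensity (f i) (LX i) LZ (a n i) (pathShift n ζ) := by
      filter_upwards [hae] with ζ hζ
      simp_rw [hζ]
      by_cases hmem : ζ ∈ pathCylinder n (pathMap z a)
      · simp only [Set.indicator_of_mem hmem, Finset.prod_mul_distrib, r]
      · simp only [Set.indicator_of_notMem hmem]
        exact Finset.prod_eq_zero (Finset.mem_univ i₀) rfl
    rw [lintegral_congr_ae hint, lintegral_indicator (measurableSet_pathCylinder _ _),
      lintegral_const_mul _ (by fun_prop),
      ← lintegral_map (f := fun ζ => ∏ i, futureDensity (f i) (LX i) LZ (a n i) ζ)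
        (by fun_prop) (measurable_pathShift n), hLZ, lintegral_smul_measure, he, one_mul,
      smul_eq_mul, mul_assoc]
    rfl
  · push Not at hagree
    obtain ⟨m, hm, i, hi⟩ := hagree
    have he : ∏ m ∈ Finset.range (n + 1), e (a m) = 0 :=
      Finset.prod_eq_zero (Finset.mem_range.2 (Nat.lt_succ_of_le hm))
        (if_neg fun h => hi (h i))
    rw [he, zero_mul, zero_mul]
    refine (lintegral_congr_ae ?_).trans lintegral_zero
    filter_upwards [hae] with ζ hζ
    by_cases hmem : ζ ∈ pathCylinder n (pathMap (f i) fun m => a m i)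
    · refine Finset.prod_eq_zero (Finset.mem_univ i₀) ?_
      rw [hζ, Set.indicator_of_notMem]
      exact fun h => hi ((hmem m hm).symm.trans (h m hm))
    · refine Finset.prod_eq_zero (Finset.mem_univ i) ?_
      rw [hζ, Set.indicator_of_notMem hmem]

end

end Coupling

/-- **Coupling of many chains.** Time-homogeneous Markov chains `X̄⁽¹⁾,…,X̄⁽ᵏ⁾` with a common
Markov image chain `Z̄` under maps `f i` admit a time-homogeneous Markov coupling whose
coordinates have the prescribed laws, agree after applying the `f i` at all times, and are
mutually conditionally independent given the common image process. -/
theorem statement_4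
    {k : ℕ} (hk : 0 < k)
    {A : Fin k → Type*} [∀ i, Countable (A i)]
    [∀ i, MeasurableSpace (A i)] [∀ i, MeasurableSingletonClass (A i)]
    {C : Type*} [Countable C] [MeasurableSpace C] [MeasurableSingletonClass C]
    (αX : ∀ i, A i → ℝ≥0∞) (PX : ∀ i, A i → A i → ℝ≥0∞) (μX : ∀ i, Measure (ℕ → A i))
    (αZ : C → ℝ≥0∞) (PZ : C → C → ℝ≥0∞) (μZ : Measure (ℕ → C))
    (f : ∀ i, A i → C)
    (hX : ∀ i, IsMarkovChain (αX i) (PX i) (μX i))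
    (hZ : IsMarkovChain αZ PZ μZ)
    (hf : ∀ i, (μX i).map (fun ω n => f i (ω n)) = μZ) :
    ∃ (αW : (∀ i, A i) → ℝ≥0∞) (PW : (∀ i, A i) → (∀ i, A i) → ℝ≥0∞)
      (μW : Measure (ℕ → ∀ i, A i)),
      IsMarkovChain αW PW μW ∧
      (∀ i, μW.map (fun ω n => ω n i) = μX i) ∧
      (∀ᵐ ω ∂μW, ∀ (i j : Fin k) (t : ℕ), f i (ω t i) = f j (ω t j)) ∧
      iCondIndepGiven μW (fun ω n => f ⟨0, hk⟩ (ω n ⟨0, hk⟩)) (fun i ω n => ω n i) := by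
  have := hZ.1
  have := fun i => (hX i).1
  choose κ hκ_markov hκ using fun i => exists_conditional_law (f := f i) (hf i)
  obtain ⟨v, P, hvP⟩ := exists_isMarkovChain_couplingMeasure hX hZ hf hκ ⟨0, hk⟩
  exact ⟨v, P, couplingMeasure μZ κ, hvP, couplingMeasure_map_eval hκ,
    ae_couplingMeasure_eq hκ, iCondIndepGiven_couplingMeasure hκ ⟨0, hk⟩⟩
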